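/- arXiv:1710.08058 — 2 statements merged into one kernel-verified Lean document; each statement's English description precedes it below -/
import Mathlib

section
/- For every β ∈ (0,1) and all s, t ≥ 0, ∫_0^∞ (e^{−2r|t−s|} − e^{−2r(t+s)})/4 · β r^{−β−1} dr = Γ(1−β) 2^{β−2} ( (s+t)^β − |t−s|^β ). (The left-hand side is ∫_0^∞ Cov(1{N(rt) odd}, 1{N(rs) odd}) β r^{−β−1} dr for a unit-rate Poisson process N, i.e. the covariance function of the limiting Gaussian process in the one-parameter case, which is a bi-fractional Brownian motion with parameters H = 1/2, K = β up to a multiplicative constant.) -/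
open MeasureTheory Filter Topology Set

lemma integrableOn_one_sub_exp_mul_rpow {β c : ℝ} (hβ : β ∈ Ioo (0 : ℝ) 1) (hc : 0 ≤ c) :
    IntegrableOn (fun r : ℝ => (1 - Real.exp (-(c * r))) * (β * r ^ (-β - 1))) (Ioi 0) := by
  obtain ⟨hβ0, hβ1⟩ := hβ
  have hmeas : Measurable fun r : ℝ => (1 - Real.exp (-(c * r))) * (β * r ^ (-β - 1)) := by
    fun_prop
  rw [← Ioc_union_Ioi_eq_Ioi zero_le_one]
  refine IntegrableOn.union ?_ ?_
  · have h : IntegrableOn (fun r : ℝ => c * β * r ^ (-β)) (Ioc 0 1) := by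
      rw [← intervalIntegrable_iff_integrableOn_Ioc_of_le zero_le_one]
      exact (intervalIntegral.intervalIntegrable_rpow' (by linarith)).const_mul _
    refine Integrable.mono' h hmeas.aestronglyMeasurable ?_
    filter_upwards [ae_restrict_mem measurableSet_Ioc] with r hr
    have hr0 : 0 < r := hr.1
    have hle : Real.exp (-(c * r)) ≤ 1 := Real.exp_le_one_iff.2 (by nlinarith)
    have hge : 1 - Real.exp (-(c * r)) ≤ c * r := by
      linarith [Real.add_one_le_exp (-(c * r))]
    have hnonneg : 0 ≤ β * r ^ (-β - 1) := by positivity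
    rw [Real.norm_of_nonneg (mul_nonneg (by linarith) hnonneg)]
    calc (1 - Real.exp (-(c * r))) * (β * r ^ (-β - 1))
        ≤ c * r * (β * r ^ (-β - 1)) := mul_le_mul_of_nonneg_right hge hnonneg
      _ = c * β * r ^ (-β) := by
        rw [Real.rpow_sub_one hr0.ne']
        field_simp
  · have h : IntegrableOn (fun r : ℝ => β * r ^ (-β - 1)) (Ioi 1) :=
      (integrableOn_Ioi_rpow_of_lt (by linarith) one_pos).const_mul _
    refine Integrable.mono' h hmeas.aestronglyMeasurable ?_
    filter_upwards [ae_restrict_mem measurableSet_Ioi] with r hr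
    have hr0 : 0 < r := one_pos.trans hr
    have hle : Real.exp (-(c * r)) ≤ 1 := Real.exp_le_one_iff.2 (by nlinarith)
    have hnonneg : 0 ≤ β * r ^ (-β - 1) := by positivity
    rw [Real.norm_of_nonneg (mul_nonneg (by linarith) hnonneg)]
    exact mul_le_of_le_one_left hnonneg (by linarith [Real.exp_pos (-(c * r))])

lemma integral_one_sub_exp_mul_rpow {β c : ℝ} (hβ : β ∈ Ioo (0 : ℝ) 1) (hc : 0 ≤ c) :
    ∫ r in Ioi (0 : ℝ), (1 - Real.exp (-(c * r))) * (β * r ^ (-β - 1)) =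
      Real.Gamma (1 - β) * c ^ β := by
  have hint := integrableOn_one_sub_exp_mul_rpow hβ hc
  obtain ⟨hβ0, hβ1⟩ := hβ
  rcases hc.eq_or_lt with rfl | hc
  · simp [Real.zero_rpow hβ0.ne']
  have hgamma := Real.integral_rpow_mul_exp_neg_mul_Ioi (sub_pos.2 hβ1) hc
  have hgammaInt : IntegrableOn (fun r : ℝ => r ^ (1 - β - 1) * Real.exp (-(c * r))) (Ioi 0) :=
    .of_integral_ne_zero (by
      rw [hgamma]
      have := Real.Gamma_pos_of_pos (sub_pos.2 hβ1)
      positivity)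
  have hfun : (fun r : ℝ => c * Real.exp (-(c * r)) * -r ^ (-β)) =
      fun r => -c * (r ^ (1 - β - 1) * Real.exp (-(c * r))) := by
    ext r
    rw [show 1 - β - 1 = -β by ring]
    ring
  have hzero : Tendsto (fun r : ℝ => (1 - Real.exp (-(c * r))) * -r ^ (-β))
      (𝓝[>] 0) (𝓝 0) := by
    have h : Tendsto (fun r : ℝ => c * r ^ (1 - β)) (𝓝[>] 0) (𝓝 0) := by
      have : Tendsto (fun r : ℝ => c * r ^ (1 - β)) (𝓝 0) (𝓝 (c * 0 ^ (1 - β))) :=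
        ((Real.continuousAt_rpow_const 0 (1 - β) (Or.inr (by linarith))).tendsto).const_mul c
      rw [Real.zero_rpow (by linarith), mul_zero] at this
      exact this.mono_left nhdsWithin_le_nhds
    refine squeeze_zero_norm' ?_ h
    filter_upwards [self_mem_nhdsWithin] with r (hr : 0 < r)
    have hle : Real.exp (-(c * r)) ≤ 1 := Real.exp_le_one_iff.2 (by nlinarith)
    have hnonneg : 0 ≤ r ^ (-β) := by positivity
    rw [norm_mul, norm_neg, Real.norm_of_nonneg (sub_nonneg.2 hle), Real.norm_of_nonneg hnonneg]
    calc (1 - Real.exp (-(c * r))) * r ^ (-β) ≤ c * r * r ^ (-β) :=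
          mul_le_mul_of_nonneg_right (by linarith [Real.add_one_le_exp (-(c * r))]) hnonneg
      _ = c * r ^ (1 - β) := by
        rw [sub_eq_add_neg, Real.rpow_add hr, Real.rpow_one, mul_assoc]
  have hinfty : Tendsto (fun r : ℝ => (1 - Real.exp (-(c * r))) * -r ^ (-β)) atTop (𝓝 0) := by
    refine squeeze_zero_norm' ?_ (tendsto_rpow_neg_atTop hβ0)
    filter_upwards [eventually_gt_atTop 0] with r hr
    have hle : Real.exp (-(c * r)) ≤ 1 := Real.exp_le_one_iff.2 (by nlinarith)
    have hnonneg : 0 ≤ r ^ (-β) := by positivity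
    rw [norm_mul, norm_neg, Real.norm_of_nonneg (sub_nonneg.2 hle), Real.norm_of_nonneg hnonneg]
    exact mul_le_of_le_one_left hnonneg (by linarith [Real.exp_pos (-(c * r))])
  have hparts := integral_Ioi_mul_deriv_eq_deriv_mul
    (u := fun r : ℝ => 1 - Real.exp (-(c * r))) (v := fun r : ℝ => -r ^ (-β))
    (u' := fun r : ℝ => c * Real.exp (-(c * r))) (v' := fun r : ℝ => β * r ^ (-β - 1))
    (a := 0) (a' := 0) (b' := 0)
    (fun r _ => by
      have h := (((hasDerivAt_id r).const_mul c).neg.exp).const_sub 1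
      refine h.congr_deriv ?_
      simp
      ring)
    (fun r hr => by
      refine (Real.hasDerivAt_rpow_const (Or.inl (ne_of_gt hr))).neg.congr_deriv ?_
      ring)
    hint
    (by
      change IntegrableOn (fun r : ℝ => c * Real.exp (-(c * r)) * -r ^ (-β)) (Ioi 0)
      rw [hfun]
      exact hgammaInt.const_mul _)
    hzero hinfty
  rw [hparts, hfun, integral_const_mul, hgamma, one_div, Real.inv_rpow hc.le,
    Real.rpow_sub hc, Real.rpow_one]
  field_simp
  ring

theorem stmt_3 (β : ℝ) (hβ : β ∈ Set.Ioo (0:ℝ) 1) (s t : ℝ) (hs : 0 ≤ s) (ht : 0 ≤ t) :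
    ∫ r in Set.Ioi (0:ℝ),
        (Real.exp (-2 * r * |t - s|) - Real.exp (-2 * r * (t + s))) / 4 * (β * r ^ (-β - 1))
      = Real.Gamma (1 - β) * (2:ℝ) ^ (β - 2) * ((s + t) ^ β - |t - s| ^ β) := by
  have hsum : 0 ≤ 2 * (s + t) := by positivity
  have hdiff : 0 ≤ 2 * |t - s| := by positivity
  have hfun : (fun r : ℝ => (Real.exp (-2 * r * |t - s|) - Real.exp (-2 * r * (t + s))) / 4 *
      (β * r ^ (-β - 1))) = fun r => 1 / 4 *
        ((1 - Real.exp (-(2 * (s + t) * r))) * (β * r ^ (-β - 1)) -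
          (1 - Real.exp (-(2 * |t - s| * r))) * (β * r ^ (-β - 1))) := by
    ext r
    rw [show -2 * r * |t - s| = -(2 * |t - s| * r) by ring,
      show -2 * r * (t + s) = -(2 * (s + t) * r) by ring]
    ring
  rw [hfun, integral_const_mul,
    integral_sub (integrableOn_one_sub_exp_mul_rpow hβ hsum)
      (integrableOn_one_sub_exp_mul_rpow hβ hdiff),
    integral_one_sub_exp_mul_rpow hβ hsum, integral_one_sub_exp_mul_rpow hβ hdiff,
    Real.mul_rpow zero_le_two (add_nonneg hs ht), Real.mul_rpow zero_le_two (abs_nonneg _),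
    Real.rpow_sub zero_lt_two, Real.rpow_two]
  ring
end

section
/- For any sequence y : ℕ → ℕ, any sequence e : ℕ → ℝ and any n ∈ ℕ, the randomized odd-occupancy sum admits the stationary-increment representation ∑_{k≥1} e_k · 1{ #{1 ≤ i ≤ n : y_i = k} is odd } = ∑_{i=1}^n ( − e_{y_i} (−1)^{#{1 ≤ j ≤ i : y_j = y_i}} ). (The left-hand side has only finitely many nonzero terms since at most n values k occur among y_1,...,y_n.) -/
/-- Occupancy count: `#{1 ≤ i ≤ n : y i = k}`. -/
def occ (y : ℕ → ℕ) (n k : ℕ) : ℕ :=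
  ((Finset.Icc 1 n).filter (fun i => y i = k)).card

theorem occ_succ (y : ℕ → ℕ) (n k : ℕ) :
    occ y (n + 1) k = occ y n k + if k = y (n + 1) then 1 else 0 := by
  simp only [occ, Finset.card_filter, eq_comm (a := k)]
  exact Finset.sum_Icc_succ_top (by omega) _

theorem ite_odd_succ (m : ℕ) (a : ℝ) :
    (if (m + 1) % 2 = 1 then a else 0)
      = (if m % 2 = 1 then a else 0) + -a * (-1 : ℝ) ^ (m + 1) := by
  rcases Nat.even_or_odd m with h | h
  · have h₀ := Nat.even_iff.mp h
    have h₁ := Nat.odd_iff.mp h.add_one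
    simp [h₀, h₁, h.add_one.neg_one_pow]
  · have h₀ := Nat.odd_iff.mp h
    have h₁ := Nat.even_iff.mp h.add_one
    simp [h₀, h₁, h.add_one.neg_one_pow]

theorem hasSum_odd_occ (y : ℕ → ℕ) (e : ℕ → ℝ) (n : ℕ) :
    HasSum (fun k => if occ y n k % 2 = 1 then e k else 0)
      (∑ i ∈ Finset.Icc 1 n, (-(e (y i)) * (-1 : ℝ) ^ (occ y i (y i)))) := by
  induction n with
  | zero => simp [occ]
  | succ n ih =>
    rw [Finset.sum_Icc_succ_top (by omega)]
    convert ih.add (hasSum_ite_eq (y (n + 1))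
      (-(e (y (n + 1))) * (-1 : ℝ) ^ (occ y (n + 1) (y (n + 1))))) using 1
    funext k
    by_cases hk : k = y (n + 1)
    · subst hk
      simpa [occ_succ] using ite_odd_succ (occ y n (y (n + 1))) (e (y (n + 1)))
    · simp [occ_succ, hk]

theorem stmt_10 (y : ℕ → ℕ) (e : ℕ → ℝ) (n : ℕ) :
    ∑' k : ℕ, (if occ y n k % 2 = 1 then e k else 0)
      = ∑ i ∈ Finset.Icc 1 n, (-(e (y i)) * (-1 : ℝ) ^ (occ y i (y i))) :=
  (hasSum_odd_occ y e n).tsum_eq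
end
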